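/- Kahn–Kalai–Linial theorem: let f : {-1,1}^n → {-1,1} with E_x[f(x)] = 0, and let α := max_{i∈[n]} Inf_i(f). Then 3 · 9^{−Inf(f)} ≤ α^{1/2}, where Inf(f) = Σ_{i=1}^n Inf_i(f); consequently there is a universal constant c > 0 with Inf(f) ≥ c · log(1/α). -/

import Mathlib

open Finset

/-- The real value of a cube coordinate: `true ↦ 1`, `false ↦ -1`. -/
noncomputable def bR (b : Bool) : ℝ := if b then 1 else -1

/-- Expectation over a uniformly random point of the cube `{-1,1}ⁿ`. -/
noncomputable def expect {n : ℕ} (g : (Fin n → Bool) → ℝ) : ℝ :=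
  (∑ x : Fin n → Bool, g x) / 2 ^ n

/-- The character `χ_S(x) = ∏_{i ∈ S} x i`. -/
noncomputable def chi {n : ℕ} (S : Finset (Fin n)) (x : Fin n → Bool) : ℝ :=
  ∏ i ∈ S, bR (x i)

/-- The Fourier coefficient `f̂(S) = E[f(x) χ_S(x)]`. -/
noncomputable def fhat {n : ℕ} (f : (Fin n → Bool) → ℝ) (S : Finset (Fin n)) : ℝ :=
  expect fun x => f x * chi S x

/-- The influence `Inf_i(f) = Pr[f(x) ≠ f(x^{⊕i})]` of coordinate `i` on a
Boolean-valued `f`. -/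
noncomputable def prInf {n : ℕ} (f : (Fin n → Bool) → ℝ) (i : Fin n) : ℝ :=
  expect fun x => if f x ≠ f (Function.update x i (!(x i))) then (1 : ℝ) else 0

section Expectation

variable {n : ℕ}

theorem expect_add (g h : (Fin n → Bool) → ℝ) :
    expect (fun x => g x + h x) = expect g + expect h := by
  simp only [_root_.expect, Finset.sum_add_distrib, add_div]

theorem expect_const_mul (c : ℝ) (g : (Fin n → Bool) → ℝ) :
    expect (fun x => c * g x) = c * expect g := by
  simp only [_root_.expect, ← Finset.mul_sum, mul_div_assoc]

theorem expect_sum {ι : Type*} (s : Finset ι) (g : ι → (Fin n → Bool) → ℝ) :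
    expect (fun x => ∑ k ∈ s, g k x) = ∑ k ∈ s, expect (g k) := by
  simp only [_root_.expect, Finset.sum_comm (s := Finset.univ) (t := s), Finset.sum_div]

theorem expect_nonneg {g : (Fin n → Bool) → ℝ} (hg : ∀ x, 0 ≤ g x) : 0 ≤ expect g :=
  div_nonneg (Finset.sum_nonneg fun x _ => hg x) (by positivity)

theorem expect_one : expect (fun _ : Fin n → Bool => (1 : ℝ)) = 1 := by
  simp [_root_.expect]

theorem sq_expect_mul_le (g h : (Fin n → Bool) → ℝ) :
    expect (fun x => g x * h x) ^ 2 ≤ expect (fun x => g x ^ 2) * expect (fun x => h x ^ 2) := by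
  unfold _root_.expect
  rw [div_pow, div_mul_div_comm, ← sq]
  gcongr
  exact Finset.sum_mul_sq_le_sq_mul_sq _ _ _

/-- The point of the cube with coordinate `i` negated. -/
def flipAt (i : Fin n) (x : Fin n → Bool) : Fin n → Bool :=
  Function.update x i (!(x i))

theorem flipAt_involutive (i : Fin n) : Function.Involutive (flipAt i) := by
  intro x
  simp [flipAt]

theorem expect_flipAt (i : Fin n) (g : (Fin n → Bool) → ℝ) :
    expect (fun x => g (flipAt i x)) = expect g := by
  unfold _root_.expect
  congr 1
  exact Equiv.sum_comp (flipAt_involutive i).toPerm g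

theorem expect_eq_zero_of_odd (i : Fin n) {g : (Fin n → Bool) → ℝ}
    (hg : ∀ x, g (flipAt i x) = -g x) : expect g = 0 := by
  have h := expect_flipAt i g
  have h' := expect_const_mul (-1) g
  simp only [neg_one_mul] at h'
  simp only [hg, h'] at h
  linarith

end Expectation

section Characters

variable {n : ℕ}

theorem bR_mul_self (b : Bool) : bR b * bR b = 1 := by
  cases b <;> simp [bR]

theorem bR_flipAt_self (i : Fin n) (x : Fin n → Bool) : bR (flipAt i x i) = -bR (x i) := by
  cases h : x i <;> simp [flipAt, bR, h]

theorem chi_flipAt_of_notMem {i : Fin n} {S : Finset (Fin n)} (hi : i ∉ S) (x : Fin n → Bool) :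
    chi S (flipAt i x) = chi S x := by
  refine Finset.prod_congr rfl fun j hj => ?_
  have hji : j ≠ i := fun h => hi (h ▸ hj)
  simp [flipAt, hji]

theorem chi_insert {i : Fin n} {S : Finset (Fin n)} (hi : i ∉ S) (x : Fin n → Bool) :
    chi (insert i S) x = bR (x i) * chi S x :=
  Finset.prod_insert hi

theorem chi_flipAt_of_mem {i : Fin n} {S : Finset (Fin n)} (hi : i ∈ S) (x : Fin n → Bool) :
    chi S (flipAt i x) = -chi S x := by
  rw [← Finset.insert_erase hi, chi_insert (Finset.notMem_erase i S),
    chi_insert (Finset.notMem_erase i S), bR_flipAt_self,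
    chi_flipAt_of_notMem (Finset.notMem_erase i S), neg_mul]

theorem sum_chi_mul_chi (x y : Fin n → Bool) :
    ∑ S : Finset (Fin n), chi S x * chi S y = if x = y then 2 ^ n else 0 := by
  have h : ∑ S : Finset (Fin n), chi S x * chi S y = ∏ i, (1 + bR (x i) * bR (y i)) := by
    rw [Finset.prod_one_add, Finset.powerset_univ]
    simp only [chi, Finset.prod_mul_distrib]
  rw [h]
  split_ifs with hxy
  · subst hxy
    simp only [bR_mul_self]
    norm_num
  · obtain ⟨i, hi⟩ := Function.ne_iff.mp hxy
    refine Finset.prod_eq_zero (Finset.mem_univ i) ?_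
    cases hx : x i <;> cases hy : y i <;> simp_all [bR]

theorem sum_fhat_sq (f : (Fin n → Bool) → ℝ) :
    ∑ S, fhat f S ^ 2 = expect fun x => f x ^ 2 := by
  have h : ∀ S, fhat f S ^ 2 =
      (∑ x, ∑ y, f x * f y * (chi S x * chi S y)) / (2 ^ n * 2 ^ n) := by
    intro S
    rw [fhat, _root_.expect, div_pow, sq, sq, Finset.sum_mul_sum]
    congr 1
    exact Finset.sum_congr rfl fun x _ => Finset.sum_congr rfl fun y _ => by ring
  simp only [h]
  rw [← Finset.sum_div, Finset.sum_comm]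
  have h' : ∀ x, ∑ S, ∑ y, f x * f y * (chi S x * chi S y) = 2 ^ n * f x ^ 2 := by
    intro x
    rw [Finset.sum_comm]
    simp only [← Finset.mul_sum, sum_chi_mul_chi]
    simp only [mul_ite, mul_zero, Finset.sum_ite_eq, Finset.mem_univ, if_true]
    ring
  simp only [h', ← Finset.mul_sum, _root_.expect]
  rw [mul_div_mul_left _ _ (by positivity)]

end Characters

section Hypercontractivity

variable {n : ℕ}

/-- The `(2, 4)`-hypercontractive inequality of Bonami, for polynomials in the coordinates
of `U`. -/
theorem bonami_powerset {ρ : ℝ} (hρ : ρ ^ 2 = 1 / 3) (U : Finset (Fin n)) :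
    ∀ c : Finset (Fin n) → ℝ,
      expect (fun x => (∑ S ∈ U.powerset, ρ ^ #S * c S * chi S x) ^ 4) ≤
        (∑ S ∈ U.powerset, c S ^ 2) ^ 2 := by
  induction U using Finset.induction_on with
  | empty =>
    intro c
    simp only [Finset.powerset_empty, Finset.sum_singleton, Finset.card_empty, pow_zero, one_mul,
      chi, Finset.prod_empty, mul_one, _root_.expect]
    simp [← pow_mul]
  | insert a U ha ih =>
    intro c
    set p : (Fin n → Bool) → ℝ := fun x => ∑ S ∈ U.powerset, ρ ^ #S * c S * chi S x with hp
    set q : (Fin n → Bool) → ℝ :=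
      fun x => ∑ S ∈ U.powerset, ρ ^ #S * c (insert a S) * chi S x with hq
    set P := ∑ S ∈ U.powerset, c S ^ 2
    set Q := ∑ S ∈ U.powerset, c (insert a S) ^ 2
    have hP : expect (fun x => p x ^ 4) ≤ P ^ 2 := ih c
    have hQ : expect (fun x => q x ^ 4) ≤ Q ^ 2 := ih fun S => c (insert a S)
    have hP0 : 0 ≤ P := Finset.sum_nonneg fun _ _ => sq_nonneg _
    have hQ0 : 0 ≤ Q := Finset.sum_nonneg fun _ _ => sq_nonneg _
    have hmem : ∀ S ∈ U.powerset, a ∉ S := fun S hS h => ha (Finset.mem_powerset.mp hS h)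
    have hsplit : ∀ x, ∑ S ∈ (insert a U).powerset, ρ ^ #S * c S * chi S x =
        p x + ρ * bR (x a) * q x := by
      intro x
      rw [Finset.sum_powerset_insert ha, hp, hq]
      simp only [Finset.mul_sum]
      congr 1
      refine Finset.sum_congr rfl fun S hS => ?_
      rw [Finset.card_insert_of_notMem (hmem S hS), chi_insert (hmem S hS)]
      ring
    have hpf : ∀ x, p (flipAt a x) = p x := fun x =>
      Finset.sum_congr rfl fun S hS => by rw [chi_flipAt_of_notMem (hmem S hS)]
    have hqf : ∀ x, q (flipAt a x) = q x := fun x =>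
      Finset.sum_congr rfl fun S hS => by rw [chi_flipAt_of_notMem (hmem S hS)]
    have hexpand : ∀ x, (p x + ρ * bR (x a) * q x) ^ 4 =
        (p x ^ 4 + (2 * (p x ^ 2 * q x ^ 2) + 1 / 9 * q x ^ 4)) +
          bR (x a) * (4 * ρ * p x ^ 3 * q x + 4 / 3 * ρ * p x * q x ^ 3) := by
      intro x
      have hb := bR_mul_self (x a)
      have hb2 : bR (x a) ^ 2 = 1 := by rw [sq, hb]
      linear_combination
        (6 * p x ^ 2 * q x ^ 2 * bR (x a) ^ 2 + 4 * p x * q x ^ 3 * ρ * bR (x a) ^ 3 +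
          q x ^ 4 * bR (x a) ^ 4 * (ρ ^ 2 + 1 / 3)) * hρ +
        (2 * p x ^ 2 * q x ^ 2 + 4 / 3 * p x * q x ^ 3 * ρ * bR (x a) +
          1 / 9 * q x ^ 4 * (bR (x a) ^ 2 + 1)) * hb2
    have hodd : expect (fun x =>
        bR (x a) * (4 * ρ * p x ^ 3 * q x + 4 / 3 * ρ * p x * q x ^ 3)) = 0 :=
      expect_eq_zero_of_odd a fun x => by rw [bR_flipAt_self, hpf, hqf, neg_mul]
    have hmix : expect (fun x => p x ^ 2 * q x ^ 2) ≤ P * Q := by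
      refine abs_le_of_sq_le_sq' ?_ (mul_nonneg hP0 hQ0) |>.2
      calc _ ≤ _ := sq_expect_mul_le _ _
        _ = expect (fun x => p x ^ 4) * expect (fun x => q x ^ 4) := by
          simp only [← pow_mul]
        _ ≤ P ^ 2 * Q ^ 2 :=
          mul_le_mul hP hQ (expect_nonneg fun x => by positivity) (sq_nonneg P)
        _ = (P * Q) ^ 2 := by ring
    simp only [hsplit, hexpand]
    rw [Finset.sum_powerset_insert ha, expect_add, hodd, expect_add, expect_add,
      expect_const_mul, expect_const_mul]
    nlinarith [sq_nonneg Q]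

theorem bonami {ρ : ℝ} (hρ : ρ ^ 2 = 1 / 3) (c : Finset (Fin n) → ℝ) :
    expect (fun x => (∑ S, ρ ^ #S * c S * chi S x) ^ 4) ≤ (∑ S, c S ^ 2) ^ 2 := by
  simpa using bonami_powerset hρ Finset.univ c

/-- The dual `(4/3, 2)`-hypercontractive inequality for functions with values in
`{-1, 0, 1}`. -/
theorem sq_stability_le {g : (Fin n → Bool) → ℝ} (hg : ∀ x, g x ^ 3 = g x) :
    (∑ S, (1 / 3 : ℝ) ^ #S * fhat g S ^ 2) ^ 2 ≤ expect (fun x => g x ^ 2) ^ 3 := by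
  set A := ∑ S, (1 / 3 : ℝ) ^ #S * fhat g S ^ 2 with hA
  set E := expect (fun x => g x ^ 2)
  obtain ⟨ρ, hρ⟩ : ∃ ρ : ℝ, ρ ^ 2 = 1 / 3 := ⟨√(1 / 3), Real.sq_sqrt (by norm_num)⟩
  set u : (Fin n → Bool) → ℝ := fun x => ∑ S, ρ ^ #S * (ρ ^ #S * fhat g S) * chi S x with hu
  have hE0 : 0 ≤ E := expect_nonneg fun x => sq_nonneg _
  have hcoef : ∀ S : Finset (Fin n), (ρ ^ #S * fhat g S) ^ 2 = (1 / 3 : ℝ) ^ #S * fhat g S ^ 2 := by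
    intro S
    rw [mul_pow, ← pow_mul, mul_comm #S 2, pow_mul, hρ]
  have hu4 : expect (fun x => u x ^ 4) ≤ A ^ 2 := by
    refine (bonami hρ _).trans_eq ?_
    simp only [hcoef, hA]
  have hgu : expect (fun x => g x * u x) = A := by
    simp only [hu, Finset.mul_sum]
    rw [expect_sum]
    refine Finset.sum_congr rfl fun S _ => ?_
    have h : ∀ x, g x * (ρ ^ #S * (ρ ^ #S * fhat g S) * chi S x) =
        (ρ ^ #S * (ρ ^ #S * fhat g S)) * (g x * chi S x) := fun x => by ring
    simp only [h]
    rw [expect_const_mul, ← hcoef]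
    change _ * fhat g S = _
    ring
  have hg4 : ∀ x, g x ^ 4 = g x ^ 2 := fun x => by linear_combination g x * hg x
  have h1 : A ^ 2 ≤ E * expect (fun x => g x ^ 2 * u x ^ 2) := by
    have h := sq_expect_mul_le g (fun x => g x ^ 2 * u x)
    have e1 : ∀ x, g x * (g x ^ 2 * u x) = g x * u x := fun x => by
      linear_combination u x * hg x
    have e2 : ∀ x, (g x ^ 2 * u x) ^ 2 = g x ^ 2 * u x ^ 2 := fun x => by
      linear_combination u x ^ 2 * hg4 x
    simpa only [e1, e2, hgu] using h
  have h2 : expect (fun x => g x ^ 2 * u x ^ 2) ^ 2 ≤ E * A ^ 2 := by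
    have h := sq_expect_mul_le (fun x => g x ^ 2) (fun x => u x ^ 2)
    have e1 : ∀ x, (g x ^ 2) ^ 2 = g x ^ 2 := fun x => by rw [← pow_mul, hg4]
    have e2 : ∀ x, (u x ^ 2) ^ 2 = u x ^ 4 := fun x => by ring
    simp only [e1, e2] at h
    exact h.trans (mul_le_mul_of_nonneg_left hu4 hE0)
  rcases (sq_nonneg A).eq_or_lt with hA0 | hA0
  · rw [← hA0]; positivity
  · refine le_of_mul_le_mul_right ?_ hA0
    calc A ^ 2 * A ^ 2 ≤ (E * expect (fun x => g x ^ 2 * u x ^ 2)) ^ 2 := by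
          rw [← sq]; exact pow_le_pow_left₀ hA0.le h1 2
      _ = E ^ 2 * expect (fun x => g x ^ 2 * u x ^ 2) ^ 2 := by ring
      _ ≤ E ^ 2 * (E * A ^ 2) := mul_le_mul_of_nonneg_left h2 (sq_nonneg E)
      _ = E ^ 3 * A ^ 2 := by ring

end Hypercontractivity

section Derivative

variable {n : ℕ}

/-- The discrete derivative of `f` in direction `i`. -/
noncomputable def cubeDeriv (i : Fin n) (f : (Fin n → Bool) → ℝ) (x : Fin n → Bool) : ℝ :=
  bR (x i) * (f x - f (flipAt i x)) / 2

theorem fhat_cubeDeriv (i : Fin n) (f : (Fin n → Bool) → ℝ) (S : Finset (Fin n)) :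
    fhat (cubeDeriv i f) S = if i ∈ S then 0 else fhat f (insert i S) := by
  split_ifs with hi
  · refine expect_eq_zero_of_odd i fun x => ?_
    rw [cubeDeriv, cubeDeriv, bR_flipAt_self, flipAt_involutive i x, chi_flipAt_of_mem hi]
    ring
  · have h1 : ∀ x, cubeDeriv i f x * chi S x =
        1 / 2 * (f x * chi (insert i S) x +
          f (flipAt i x) * chi (insert i S) (flipAt i x)) := by
      intro x
      rw [chi_flipAt_of_mem (Finset.mem_insert_self i S), chi_insert hi, cubeDeriv]
      ring
    simp only [fhat, h1]
    rw [expect_const_mul, expect_add, expect_flipAt i fun x => f x * chi (insert i S) x]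
    ring

theorem sum_sum_fhat_cubeDeriv (φ : ℕ → ℝ) (f : (Fin n → Bool) → ℝ) :
    ∑ i, ∑ S, φ #S * fhat (cubeDeriv i f) S ^ 2 =
      ∑ T, #T * φ (#T - 1) * fhat f T ^ 2 := by
  have h : ∀ i, ∑ S, φ #S * fhat (cubeDeriv i f) S ^ 2 =
      ∑ T : Finset (Fin n), if i ∈ T then φ (#T - 1) * fhat f T ^ 2 else 0 := by
    intro i
    have e : ∀ S, φ #S * fhat (cubeDeriv i f) S ^ 2 =
        if i ∉ S then φ #S * fhat f (insert i S) ^ 2 else 0 := by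
      intro S
      rw [fhat_cubeDeriv]
      by_cases hi : i ∈ S <;> simp [hi]
    simp only [e]
    rw [← Finset.sum_filter, ← Finset.sum_filter]
    refine Finset.sum_nbij' (fun S => insert i S) (fun T => T.erase i) ?_ ?_ ?_ ?_ ?_
    · simp
    · simp
    · intro S hS
      exact Finset.erase_insert (Finset.mem_filter.mp hS).2
    · intro T hT
      exact Finset.insert_erase (Finset.mem_filter.mp hT).2
    · intro S hS
      rw [Finset.card_insert_of_notMem (Finset.mem_filter.mp hS).2, Nat.add_sub_cancel]
  simp only [h]
  rw [Finset.sum_comm]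
  refine Finset.sum_congr rfl fun T _ => ?_
  rw [Finset.sum_ite_mem, Finset.univ_inter, Finset.sum_const, nsmul_eq_mul, mul_assoc]

variable {f : (Fin n → Bool) → ℝ}

theorem cubeDeriv_pow_three (hf : ∀ x, f x = 1 ∨ f x = -1) (i : Fin n) (x : Fin n → Bool) :
    cubeDeriv i f x ^ 3 = cubeDeriv i f x := by
  rw [cubeDeriv]
  rcases hf x with h | h <;> rcases hf (flipAt i x) with h' | h' <;> cases x i <;>
    norm_num [h, h', bR]

theorem expect_cubeDeriv_sq (hf : ∀ x, f x = 1 ∨ f x = -1) (i : Fin n) :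
    expect (fun x => cubeDeriv i f x ^ 2) = prInf f i := by
  unfold prInf
  congr 1
  funext x
  change _ = if f x ≠ f (flipAt i x) then (1 : ℝ) else 0
  rw [cubeDeriv]
  rcases hf x with h | h <;> rcases hf (flipAt i x) with h' | h' <;> cases x i <;>
    norm_num [h, h', bR]

theorem sum_prInf (hf : ∀ x, f x = 1 ∨ f x = -1) :
    ∑ i, prInf f i = ∑ T, #T * fhat f T ^ 2 := by
  simpa [← expect_cubeDeriv_sq hf, ← sum_fhat_sq] using sum_sum_fhat_cubeDeriv (fun _ => 1) f

end Derivative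

/-- Jensen's inequality for `t ↦ 3 ^ (-t)`. -/
theorem three_rpow_neg_sum_le {ι : Type*} (s : Finset ι) (w t : ι → ℝ) (hw : ∀ k ∈ s, 0 ≤ w k)
    (hw1 : ∑ k ∈ s, w k = 1) :
    (3 : ℝ) ^ (-∑ k ∈ s, w k * t k) ≤ ∑ k ∈ s, w k * (3 : ℝ) ^ (-t k) := by
  set m := ∑ k ∈ s, w k * t k with hm
  have key : ∀ k ∈ s, (3 : ℝ) ^ (-m) * (w k + (m * w k - w k * t k) * Real.log 3) ≤
      w k * (3 : ℝ) ^ (-t k) := by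
    intro k hk
    have h := Real.add_one_le_exp (Real.log 3 * (m - t k))
    rw [← Real.rpow_def_of_pos (by norm_num : (0 : ℝ) < 3)] at h
    have e : (3 : ℝ) ^ (-t k) = (3 : ℝ) ^ (-m) * (3 : ℝ) ^ (m - t k) := by
      rw [← Real.rpow_add (by norm_num : (0 : ℝ) < 3)]
      congr 1
      ring
    have h3 : (0 : ℝ) ≤ 3 ^ (-m) := by positivity
    rw [e]
    nlinarith [mul_le_mul_of_nonneg_left h (mul_nonneg h3 (hw k hk))]
  refine le_trans (le_of_eq ?_) (Finset.sum_le_sum key)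
  rw [← Finset.mul_sum, Finset.sum_add_distrib, ← Finset.sum_mul, Finset.sum_sub_distrib,
    ← Finset.mul_sum, hw1, ← hm]
  ring

theorem le_three_rpow (t : ℝ) : t ≤ (3 : ℝ) ^ t := by
  rcases le_total t 0 with ht | ht
  · exact ht.trans (by positivity)
  · have h : Real.exp t ≤ (3 : ℝ) ^ t := by
      rw [← Real.exp_one_rpow]
      exact Real.rpow_le_rpow (Real.exp_pos 1).le (Real.exp_one_lt_d9.le.trans (by norm_num)) ht
    linarith [Real.add_one_le_exp t]

theorem three_mul_nine_rpow_neg_le {n : ℕ} {f : (Fin n → Bool) → ℝ} {α : ℝ}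
    (hf : ∀ x, f x = 1 ∨ f x = -1) (hbal : expect f = 0) (hα : ∀ i, prInf f i ≤ α) :
    3 * (9 : ℝ) ^ (-(∑ i, prInf f i)) ≤ √α := by
  set I := ∑ i, prInf f i with hI
  have hpos : ∀ i, 0 ≤ prInf f i := fun i => expect_nonneg fun x => by split_ifs <;> norm_num
  have hweight : ∑ T, fhat f T ^ 2 = 1 := by
    have h : ∀ x, f x ^ 2 = 1 := fun x => by rcases hf x with h | h <;> norm_num [h]
    rw [sum_fhat_sq]
    simp only [h, expect_one]
  have hempty : fhat f ∅ = 0 := by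
    simpa [fhat, chi] using hbal
  have hstab : ∀ i, ∑ S, (1 / 3 : ℝ) ^ #S * fhat (cubeDeriv i f) S ^ 2 ≤ √α * prInf f i := by
    intro i
    have h := sq_stability_le (cubeDeriv_pow_three hf i)
    rw [expect_cubeDeriv_sq hf] at h
    refine (abs_le_of_sq_le_sq' (h.trans ?_) (mul_nonneg (Real.sqrt_nonneg _) (hpos i))).2
    rw [mul_pow, Real.sq_sqrt ((hpos i).trans (hα i)), pow_succ' _ 2]
    exact mul_le_mul_of_nonneg_right (hα i) (sq_nonneg _)
  have hupper : ∑ T, #T * (1 / 3 : ℝ) ^ (#T - 1) * fhat f T ^ 2 ≤ √α * I := by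
    rw [← sum_sum_fhat_cubeDeriv (fun k => (1 / 3 : ℝ) ^ k), hI, Finset.mul_sum]
    exact Finset.sum_le_sum fun i _ => hstab i
  have hlower : 3 * (3 : ℝ) ^ (-I) ≤ ∑ T, #T * (1 / 3 : ℝ) ^ (#T - 1) * fhat f T ^ 2 := by
    have h := three_rpow_neg_sum_le Finset.univ (fun T => fhat f T ^ 2) (fun T => (#T : ℝ))
      (fun _ _ => sq_nonneg _) hweight
    have hI' : ∑ T, fhat f T ^ 2 * #T = I := by
      rw [hI, sum_prInf hf]
      exact Finset.sum_congr rfl fun _ _ => mul_comm _ _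
    rw [hI'] at h
    refine (mul_le_mul_of_nonneg_left h (by norm_num)).trans ?_
    rw [Finset.mul_sum]
    refine Finset.sum_le_sum fun T _ => ?_
    rcases T.eq_empty_or_nonempty with rfl | hT
    · simp [hempty]
    · obtain ⟨k, hk⟩ : ∃ k, #T = k + 1 := ⟨#T - 1, by have := hT.card_pos; omega⟩
      have e : (3 : ℝ) ^ (-((k + 1 : ℕ) : ℝ)) = 1 / 3 * (1 / 3) ^ k := by
        rw [Real.rpow_neg (by norm_num), Real.rpow_natCast, ← inv_pow, pow_succ', one_div]
      rw [hk, e, Nat.add_sub_cancel]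
      have hk0 : 0 ≤ (k : ℝ) * ((1 / 3 : ℝ) ^ k * fhat f T ^ 2) := by positivity
      push_cast
      linarith
  have h3 : (0 : ℝ) < 3 ^ (-I) := by positivity
  have hnine : (9 : ℝ) ^ (-I) = 3 ^ (-I) * 3 ^ (-I) := by
    rw [← Real.mul_rpow (by norm_num) (by norm_num)]
    norm_num
  have hle : I * 3 ^ (-I) ≤ 1 := by
    have h := mul_le_mul_of_nonneg_right (le_three_rpow I) h3.le
    rwa [← Real.rpow_add (by norm_num), add_neg_cancel, Real.rpow_zero] at h
  calc 3 * (9 : ℝ) ^ (-I) = 3 * 3 ^ (-I) * 3 ^ (-I) := by rw [hnine, mul_assoc]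
    _ ≤ √α * I * 3 ^ (-I) := mul_le_mul_of_nonneg_right (hlower.trans hupper) h3.le
    _ = √α * (I * 3 ^ (-I)) := mul_assoc _ _ _
    _ ≤ √α := mul_le_of_le_one_right (Real.sqrt_nonneg _) hle

/-- **Kahn–Kalai–Linial.** There is a universal constant `c > 0` such that: for every
balanced `f : {-1,1}ⁿ → {-1,1}` with maximum influence `α = maxᵢ Inf_i(f)`, one has
`3 · 9^{-Inf(f)} ≤ α^{1/2}` and consequently `Inf(f) ≥ c · log(1/α)`. -/
theorem kahn_kalai_linial :
    ∃ c : ℝ, 0 < c ∧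
      ∀ (n : ℕ) (f : (Fin n → Bool) → ℝ) (α : ℝ),
        (∀ x, f x = 1 ∨ f x = -1) →
        expect f = 0 →
        IsGreatest (Set.range fun i : Fin n => prInf f i) α →
        3 * (9 : ℝ) ^ (-(∑ i, prInf f i)) ≤ α ^ ((1 : ℝ) / 2) ∧
        c * Real.log (1 / α) ≤ ∑ i, prInf f i := by
  have hlog9 : 0 < Real.log 9 := Real.log_pos (by norm_num)
  refine ⟨1 / (2 * Real.log 9), by positivity, fun n f α hf hbal hα => ?_⟩
  have hmain := three_mul_nine_rpow_neg_le hf hbal fun i => hα.2 ⟨i, rfl⟩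
  refine ⟨by rwa [← Real.sqrt_eq_rpow], ?_⟩
  have h9 : (0 : ℝ) < 9 ^ (-(∑ i, prInf f i)) := by positivity
  have hα0 : 0 < α := Real.sqrt_pos.mp (lt_of_lt_of_le (by positivity) hmain)
  have hlog := Real.log_le_log h9 (le_trans (by linarith) hmain)
  rw [Real.log_rpow (by norm_num), Real.log_sqrt hα0.le] at hlog
  rw [one_div α, Real.log_inv, one_div, inv_mul_le_iff₀ (by positivity)]
  linarith
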